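/- Let n ≥ 2 and let (u,v) be a solution of Δu = u v², Δv = v u², u > 0, v > 0 on ℝⁿ satisfying the linear growth condition u(x) + v(x) ≤ C₀(1 + |x|) for some constant C₀ > 0. Then there exists a constant C > 0 such that u(x)|∇v(x)| + v(x)|∇u(x)| ≤ C for all x ∈ ℝⁿ. -/

import Mathlib

open MeasureTheory Metric
open scoped RealInnerProductSpace

noncomputable section

/-- The Laplacian of a function on Euclidean space, as the trace of the second derivative. -/
def lap {n : ℕ} (u : EuclideanSpace ℝ (Fin n) → ℝ) (x : EuclideanSpace ℝ (Fin n)) : ℝ :=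
  ∑ i : Fin n, iteratedFDeriv ℝ 2 u x (fun _ => EuclideanSpace.single i 1)

/-- A (positive classical) solution of the system Δu = u v², Δv = v u², u,v > 0 on ℝⁿ. -/
def IsSolution {n : ℕ} (u v : EuclideanSpace ℝ (Fin n) → ℝ) : Prop :=
  ContDiff ℝ (⊤ : ℕ∞) u ∧ ContDiff ℝ (⊤ : ℕ∞) v ∧ (∀ x, 0 < u x) ∧ (∀ x, 0 < v x) ∧
    (∀ x, lap u x = u x * v x ^ 2) ∧ (∀ x, lap v x = v x * u x ^ 2)

/-- The second derivative of `f` at `x` in the direction `d`. -/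
def dirDeriv₂ {n : ℕ} (f : EuclideanSpace ℝ (Fin n) → ℝ) (x d : EuclideanSpace ℝ (Fin n)) : ℝ :=
  iteratedFDeriv ℝ 2 f x (fun _ => d)

section LineDerivatives

variable {n : ℕ} {f : EuclideanSpace ℝ (Fin n) → ℝ}

lemma lap_eq_sum_dirDeriv₂ (f : EuclideanSpace ℝ (Fin n) → ℝ) (x : EuclideanSpace ℝ (Fin n))
    (b : OrthonormalBasis (Fin n) ℝ (EuclideanSpace ℝ (Fin n))) :
    lap f x = ∑ i, dirDeriv₂ f x (b i) := by
  have vec (d : EuclideanSpace ℝ (Fin n)) : (fun _ : Fin 2 => d) = ![d, d] := by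
    ext i; fin_cases i <;> rfl
  have h := (InnerProductSpace.laplacian_eq_iteratedFDeriv_orthonormalBasis f
    (EuclideanSpace.basisFun (Fin n) ℝ)).symm.trans
    (InnerProductSpace.laplacian_eq_iteratedFDeriv_orthonormalBasis f b)
  simpa [lap, dirDeriv₂, vec] using congrFun h x

lemma hasDerivAt_comp_line (hf : ContDiff ℝ 2 f) (x d : EuclideanSpace ℝ (Fin n)) (t : ℝ) :
    HasDerivAt (fun s : ℝ => f (x + s • d)) (fderiv ℝ f (x + t • d) d) t := by
  have h1 : HasDerivAt (fun s : ℝ => x + s • d) d t := by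
    simpa using ((hasDerivAt_id t).smul_const d).const_add x
  exact ((hf.differentiable (by norm_num)) _).hasFDerivAt.comp_hasDerivAt t h1

lemma fderiv_fderiv_apply (hf : ContDiff ℝ 2 f) (x d : EuclideanSpace ℝ (Fin n)) :
    fderiv ℝ (fun y => fderiv ℝ f y d) x d = dirDeriv₂ f x d := by
  have h : DifferentiableAt ℝ (fderiv ℝ f) x :=
    (hf.fderiv_right (m := 1) (by norm_num)).differentiable (by norm_num) x
  rw [dirDeriv₂, iteratedFDeriv_two_apply, fderiv_clm_apply h (differentiableAt_const d)]
  simp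

lemma hasDerivAt_fderiv_comp_line (hf : ContDiff ℝ 2 f) (x d : EuclideanSpace ℝ (Fin n)) (t : ℝ) :
    HasDerivAt (fun s : ℝ => fderiv ℝ f (x + s • d) d) (dirDeriv₂ f (x + t • d) d) t := by
  have h1 : HasDerivAt (fun s : ℝ => x + s • d) d t := by
    simpa using ((hasDerivAt_id t).smul_const d).const_add x
  have h2 : DifferentiableAt ℝ (fun y => fderiv ℝ f y d) (x + t • d) :=
    ((hf.fderiv_right (m := 1) (by norm_num)).differentiable (by norm_num) _).clm_apply
      (differentiableAt_const d)
  rw [← fderiv_fderiv_apply hf]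
  exact h2.hasFDerivAt.comp_hasDerivAt t h1

end LineDerivatives

/-- The necessary second-order condition at a local maximum. -/
lemma IsLocalMax.second_deriv_nonpos {g g' : ℝ → ℝ} {a c : ℝ} (hmax : IsLocalMax g a)
    (hg : ∀ t, HasDerivAt g (g' t) t) (hg' : HasDerivAt g' c a) : c ≤ 0 := by
  by_contra! hc
  have hd : deriv g = g' := funext fun t => (hg t).deriv
  have hdd : deriv (deriv g) a = c := by rw [hd, hg'.deriv]
  have hmin : IsLocalMin g a := isLocalMin_of_deriv_deriv_pos (by rw [hdd]; exact hc)
    hmax.deriv_eq_zero (hg a).continuousAt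
  have hconst : g =ᶠ[nhds a] fun _ => g a := by
    filter_upwards [hmax, hmin] with t h1 h2 using le_antisymm h1 h2
  have : deriv (deriv g) a = 0 := by
    rw [hconst.deriv.deriv_eq]; simp
  linarith

section LineDerivatives

variable {n : ℕ} {f : EuclideanSpace ℝ (Fin n) → ℝ}

lemma dirDeriv₂_sub_dirDeriv₂_le_of_isLocalMax {g : EuclideanSpace ℝ (Fin n) → ℝ}
    (hf : ContDiff ℝ 2 f) (hg : ContDiff ℝ 2 g) {x d y e : EuclideanSpace ℝ (Fin n)} {a b c : ℝ}
    (hmax : IsLocalMax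
      (fun t : ℝ => f (x + t • d) - g (y + t • e) - (a + b * t + c * t ^ 2)) 0) :
    dirDeriv₂ f x d - dirDeriv₂ g y e ≤ 2 * c := by
  have h1 (t : ℝ) : HasDerivAt
      (fun t : ℝ => f (x + t • d) - g (y + t • e) - (a + b * t + c * t ^ 2))
      (fderiv ℝ f (x + t • d) d - fderiv ℝ g (y + t • e) e - (b + 2 * c * t)) t := by
    have := (((hasDerivAt_id t).const_mul b).const_add a).add
      (((hasDerivAt_id t).pow 2).const_mul c)
    refine ((hasDerivAt_comp_line hf x d t).sub (hasDerivAt_comp_line hg y e t)).sub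
      (this.congr_deriv ?_)
    simp; ring
  have h2 : HasDerivAt
      (fun t : ℝ => fderiv ℝ f (x + t • d) d - fderiv ℝ g (y + t • e) e - (b + 2 * c * t))
      (dirDeriv₂ f x d - dirDeriv₂ g y e - 2 * c) 0 := by
    have h3 := hasDerivAt_fderiv_comp_line hf x d 0
    have h4 := hasDerivAt_fderiv_comp_line hg y e 0
    rw [zero_smul, add_zero] at h3 h4
    refine (h3.sub h4).sub
      ((((hasDerivAt_id (0 : ℝ)).const_mul (2 * c)).const_add b).congr_deriv ?_)
    simp
  linarith [hmax.second_deriv_nonpos h1 h2]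

lemma dirDeriv₂_le_of_isLocalMax (hf : ContDiff ℝ 2 f) {x d : EuclideanSpace ℝ (Fin n)}
    {a b c : ℝ} (hmax : IsLocalMax (fun t : ℝ => f (x + t • d) - (a + b * t + c * t ^ 2)) 0) :
    dirDeriv₂ f x d ≤ 2 * c := by
  have h := dirDeriv₂_sub_dirDeriv₂_le_of_isLocalMax (g := fun _ => 0) (x := x) (d := d)
    (y := 0) (e := 0) (a := a) (b := b) (c := c) hf contDiff_const (by simpa using hmax)
  simpa [dirDeriv₂] using h

end LineDerivatives

section Barriers

variable {n : ℕ}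

lemma norm_add_smul_sq (y d : EuclideanSpace ℝ (Fin n)) (t : ℝ) :
    ‖y + t • d‖ ^ 2 = ‖y‖ ^ 2 + 2 * ⟪y, d⟫ * t + ‖d‖ ^ 2 * t ^ 2 := by
  rw [norm_add_sq_real, inner_smul_right, norm_smul, mul_pow, Real.norm_eq_abs, sq_abs]
  ring

lemma continuous_line (x d : EuclideanSpace ℝ (Fin n)) :
    Continuous fun t : ℝ => x + t • d := by fun_prop

/-- A subsolution of `Δf = κ f` is small at the centre of a ball when `κ` is large. -/
lemma le_of_mul_le_lap {f : EuclideanSpace ℝ (Fin n) → ℝ} (hf : ContDiff ℝ 2 f)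
    {x : EuclideanSpace ℝ (Fin n)} {ρ S κ : ℝ} (hρ : 0 < ρ) (hS : 0 ≤ S) (hκ : 0 < κ)
    (hfS : ∀ y ∈ closedBall x ρ, f y ≤ S) (hlap : ∀ y ∈ closedBall x ρ, κ * f y ≤ lap f y) :
    f x ≤ 2 * n * S / (ρ ^ 2 * κ) := by
  set c := S / ρ ^ 2 with hc
  have hcont : Continuous fun y => f y - c * ‖y - x‖ ^ 2 := by
    have := hf.continuous
    fun_prop
  obtain ⟨y, hy, hymax⟩ := (isCompact_closedBall x ρ).exists_isMaxOn
    ⟨x, mem_closedBall_self hρ.le⟩ hcont.continuousOn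
  have hxy : f x ≤ f y - c * ‖y - x‖ ^ 2 := by
    simpa using hymax (mem_closedBall_self hρ.le)
  have hc0 : 0 ≤ c := by positivity
  have hS' : c * ρ ^ 2 = S := by rw [hc]; field_simp
  have hrhs : 0 ≤ 2 * n * S / (ρ ^ 2 * κ) := by positivity
  rcases (mem_closedBall.1 hy).lt_or_eq with hlt | heq
  · have hdir (d : EuclideanSpace ℝ (Fin n)) (hd : ‖d‖ = 1) : dirDeriv₂ f y d ≤ 2 * c := by
      refine dirDeriv₂_le_of_isLocalMax hf (a := c * ‖y - x‖ ^ 2) (b := c * (2 * ⟪y - x, d⟫)) ?_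
      have hloc : IsLocalMax (fun y => f y - c * ‖y - x‖ ^ 2) y :=
        hymax.isLocalMax (closedBall_mem_nhds_of_mem (mem_ball.2 hlt))
      have hy0 : y + (0 : ℝ) • d = y := by simp
      have h := (hy0.symm ▸ hloc).comp_continuous (g := fun t : ℝ => y + t • d) (b := 0)
        (continuous_line y d).continuousAt
      convert h using 2 with t
      simp only [Function.comp]
      rw [add_sub_right_comm, norm_add_smul_sq, hd]; ring
    have hsum : lap f y ≤ 2 * n * c := by
      rw [lap_eq_sum_dirDeriv₂ f y (EuclideanSpace.basisFun (Fin n) ℝ)]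
      calc _ ≤ ∑ _i : Fin n, 2 * c := Finset.sum_le_sum fun i _ => hdir _ (by simp)
        _ = 2 * n * c := by simp; ring
    have h1 := (hlap y hy).trans hsum
    calc f x ≤ f y := hxy.trans (by have := mul_nonneg hc0 (sq_nonneg ‖y - x‖); linarith)
      _ ≤ 2 * n * c / κ := by rw [le_div_iff₀ hκ]; linarith
      _ = _ := by rw [hc]; field_simp
  · rw [dist_eq_norm] at heq
    rw [heq, hS'] at hxy
    linarith [hfS y hy]

lemma exists_reflection {e : EuclideanSpace ℝ (Fin n)} (he : ‖e‖ = 1) :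
    ∃ σ : EuclideanSpace ℝ (Fin n) ≃ₗᵢ[ℝ] EuclideanSpace ℝ (Fin n),
      ∀ y, σ y = y - (2 * ⟪e, y⟫) • e := by
  refine ⟨(ℝ ∙ e)ᗮ.reflection, fun y => ?_⟩
  rw [Submodule.reflection_orthogonal_apply, Submodule.reflection_singleton_apply, he]
  simp
  module

/-- Interior gradient estimate for `Δf` bounded, in a fixed direction. -/
lemma fderiv_apply_le_of_bounds {f : EuclideanSpace ℝ (Fin n) → ℝ} (hf : ContDiff ℝ 2 f)
    {x e : EuclideanSpace ℝ (Fin n)} (he : ‖e‖ = 1) {ρ S N : ℝ} (hρ : 0 < ρ)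
    (hfS : ∀ y ∈ closedBall x ρ, |f y| ≤ S) (hlap : ∀ y ∈ closedBall x ρ, |lap f y| < N) :
    fderiv ℝ f x e ≤ n * S / ρ + N * ρ / 2 := by
  obtain ⟨σ, hσ⟩ := exists_reflection he
  have hS : 0 ≤ S := (abs_nonneg _).trans (hfS x (mem_closedBall_self hρ.le))
  have hN : 0 < N := (abs_nonneg _).trans_lt (hlap x (mem_closedBall_self hρ.le))
  set γ := 2 * S / ρ ^ 2 with hγ
  set β := 2 * n * S / ρ ^ 2 + N with hβ
  have hβ0 : 0 ≤ β := by positivity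
  have hee : ⟪e, e⟫ = (1 : ℝ) := by rw [real_inner_self_eq_norm_sq, he]; norm_num
  have hball (z : EuclideanSpace ℝ (Fin n)) (hz : ‖z‖ ≤ ρ) : x + z ∈ closedBall x ρ := by
    simpa using hz
  set h : EuclideanSpace ℝ (Fin n) → ℝ := fun y =>
    f (x + y) - f (x + σ y) - (γ * ‖y‖ ^ 2 + β * ρ * ⟪e, y⟫ - β * ⟪e, y⟫ ^ 2) with hh
  have hcont : Continuous h := by
    have := hf.continuous
    have := σ.continuous
    fun_prop
  set K : Set (EuclideanSpace ℝ (Fin n)) := closedBall 0 ρ ∩ {y | 0 ≤ ⟪e, y⟫} with hK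
  have hKc : IsCompact K := (isCompact_closedBall 0 ρ).inter_right
    (isClosed_le continuous_const (by fun_prop))
  obtain ⟨y, hy, hymax⟩ := hKc.exists_isMaxOn ⟨0, by simp [hK, hρ.le]⟩ hcont.continuousOn
  have hyρ : ‖y‖ ≤ ρ := by simpa using hy.1
  have hy0 : 0 ≤ ⟪e, y⟫ := hy.2
  have hyle : ⟪e, y⟫ ≤ ρ := (real_inner_le_norm e y).trans (by rw [he]; linarith)
  have hmax0 : h y ≤ 0 := by
    rcases hy0.eq_or_lt with heq | hpos
    · have h1 : σ y = y := by rw [hσ, ← heq]; simp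
      simp only [hh, h1, ← heq]
      have : 0 ≤ γ * ‖y‖ ^ 2 := by positivity
      linarith
    rcases hyρ.lt_or_eq with hlt | heq
    · exfalso
      have hnhds : K ∈ nhds y := by
        refine Filter.inter_mem (closedBall_mem_nhds_of_mem (by simpa using hlt)) ?_
        have hopen : IsOpen {z : EuclideanSpace ℝ (Fin n) | 0 < ⟪e, z⟫} :=
          isOpen_lt continuous_const (by fun_prop)
        exact Filter.mem_of_superset (hopen.mem_nhds hpos) fun z (hz : 0 < ⟪e, z⟫) => hz.le
      have hloc : IsLocalMax h y := hymax.isLocalMax hnhds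
      have hdir (d : EuclideanSpace ℝ (Fin n)) (hd : ‖d‖ = 1) :
          dirDeriv₂ f (x + y) d - dirDeriv₂ f (x + σ y) (σ d) ≤ 2 * (γ - β * ⟪e, d⟫ ^ 2) := by
        refine dirDeriv₂_sub_dirDeriv₂_le_of_isLocalMax hf hf
          (a := γ * ‖y‖ ^ 2 + β * ρ * ⟪e, y⟫ - β * ⟪e, y⟫ ^ 2)
          (b := γ * (2 * ⟪y, d⟫) + β * ρ * ⟪e, d⟫ - β * (2 * ⟪e, y⟫ * ⟪e, d⟫)) ?_
        have hy0 : y + (0 : ℝ) • d = y := by simp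
        have h2 := (hy0.symm ▸ hloc).comp_continuous (g := fun t : ℝ => y + t • d) (b := 0)
          (continuous_line y d).continuousAt
        convert h2 using 2 with t
        simp only [Function.comp, hh, map_add, map_smul, ← add_assoc]
        rw [norm_add_smul_sq, hd, inner_add_right, inner_smul_right]; ring
      have hsum : lap f (x + y) - lap f (x + σ y) ≤ 2 * n * γ - 2 * β := by
        rw [lap_eq_sum_dirDeriv₂ f (x + y) (EuclideanSpace.basisFun (Fin n) ℝ),
          lap_eq_sum_dirDeriv₂ f (x + σ y) ((EuclideanSpace.basisFun (Fin n) ℝ).map σ),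
          ← Finset.sum_sub_distrib]
        have hnorm := (EuclideanSpace.basisFun (Fin n) ℝ).sum_sq_inner_left e
        rw [he] at hnorm
        calc _ ≤ ∑ i : Fin n, 2 * (γ - β * ⟪e, EuclideanSpace.basisFun (Fin n) ℝ i⟫ ^ 2) :=
              Finset.sum_le_sum fun i _ => by simpa using hdir _ (by simp)
          _ = 2 * n * γ - 2 * β * ∑ i, ⟪e, EuclideanSpace.basisFun (Fin n) ℝ i⟫ ^ 2 := by
              rw [← Finset.mul_sum, Finset.sum_sub_distrib, ← Finset.mul_sum]; simp; ring
          _ = _ := by rw [hnorm]; ring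
      have h3 := abs_lt.1 (hlap _ (hball y hyρ))
      have h4 := abs_lt.1 (hlap _ (hball (σ y) (by simpa using hyρ)))
      have h5 : 2 * n * γ - 2 * β = - 2 * N := by rw [hγ, hβ]; ring
      linarith [h3.1, h4.2]
    · have h3 := abs_le.1 (hfS _ (hball y hyρ))
      have h4 := abs_le.1 (hfS _ (hball (σ y) (by simpa using hyρ)))
      have h5 : γ * ρ ^ 2 = 2 * S := by rw [hγ]; field_simp
      have h6 : 0 ≤ β * ⟪e, y⟫ * (ρ - ⟪e, y⟫) := by
        have : 0 ≤ ρ - ⟪e, y⟫ := by linarith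
        positivity
      simp only [hh, heq, h5]
      nlinarith [h3.2, h4.1]
  have hline (t : ℝ) : HasDerivAt (fun t : ℝ => f (x + t • e) - f (x + t • (-e)) -
      (γ * t ^ 2 + β * ρ * t - β * t ^ 2)) (fderiv ℝ f (x + t • e) e -
        fderiv ℝ f (x + t • (-e)) (-e) - (γ * (2 * t) + β * ρ - β * (2 * t))) t := by
    refine ((hasDerivAt_comp_line hf x e t).sub (hasDerivAt_comp_line hf x (-e) t)).sub ?_
    have h1 := (hasDerivAt_id t).pow 2
    refine (((h1.const_mul γ).add ((hasDerivAt_id t).const_mul (β * ρ))).sub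
      (h1.const_mul β)).congr_deriv ?_
    simp
  have hσe (t : ℝ) : σ (t • e) = t • (-e) := by
    rw [map_smul, hσ, hee]; congr 1; module
  have hle : ∀ t ∈ Set.Icc (0 : ℝ) ρ, f (x + t • e) - f (x + t • (-e)) -
      (γ * t ^ 2 + β * ρ * t - β * t ^ 2) ≤ 0 := by
    intro t ht
    have hmem : t • e ∈ K := by
      refine ⟨by simpa [norm_smul, he, abs_of_nonneg ht.1] using ht.2, ?_⟩
      simpa [inner_smul_right, he] using ht.1
    have h1 : h (t • e) ≤ h y := hymax hmem
    have h2 := h1.trans hmax0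
    simp only [hh, hσe, inner_smul_right, hee, norm_smul, he, mul_one, Real.norm_eq_abs,
      sq_abs] at h2
    exact h2
  have hd := hline 0
  simp only [zero_smul, add_zero, map_neg] at hd
  have hlocal : IsLocalMaxOn (fun t : ℝ => f (x + t • e) - f (x + t • (-e)) -
      (γ * t ^ 2 + β * ρ * t - β * t ^ 2)) (Set.Icc 0 ρ) 0 := by
    refine IsMaxOn.localize fun t ht => ?_
    simpa using hle t ht
  have hder := hlocal.hasFDerivWithinAt_nonpos hd.hasFDerivAt.hasFDerivWithinAt
    (y := ρ) (mem_posTangentConeAt_of_segment_subset (by simp [segment_eq_Icc hρ.le]))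
  simp at hder
  have h7 : 2 * fderiv ℝ f x e ≤ β * ρ := by nlinarith
  calc fderiv ℝ f x e ≤ β * ρ / 2 := by linarith
    _ = _ := by rw [hβ]; field_simp

/-- Interior gradient estimate for functions with bounded Laplacian. -/
lemma norm_gradient_le_of_bounds {f : EuclideanSpace ℝ (Fin n) → ℝ} (hf : ContDiff ℝ 2 f)
    {x : EuclideanSpace ℝ (Fin n)} {ρ S N : ℝ} (hρ : 0 < ρ)
    (hfS : ∀ y ∈ closedBall x ρ, |f y| ≤ S) (hlap : ∀ y ∈ closedBall x ρ, |lap f y| < N) :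
    ‖gradient f x‖ ≤ n * S / ρ + N * ρ / 2 := by
  have hS : 0 ≤ S := (abs_nonneg _).trans (hfS x (mem_closedBall_self hρ.le))
  have hN : 0 < N := (abs_nonneg _).trans_lt (hlap x (mem_closedBall_self hρ.le))
  rcases eq_or_ne (gradient f x) 0 with h0 | h0
  · rw [h0, norm_zero]; positivity
  have h1 := fderiv_apply_le_of_bounds hf (e := (‖gradient f x‖)⁻¹ • gradient f x)
    (norm_smul_inv_norm h0) hρ hfS hlap
  have h2 : fderiv ℝ f x (gradient f x) = ‖gradient f x‖ ^ 2 := by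
    rw [← real_inner_self_eq_norm_sq, inner_gradient_left]
  rw [map_smul, h2, smul_eq_mul] at h1
  have h3 : ‖gradient f x‖ ≠ 0 := norm_ne_zero_iff.2 h0
  rwa [show ‖gradient f x‖⁻¹ * ‖gradient f x‖ ^ 2 = ‖gradient f x‖ by field_simp] at h1

end Barriers

section MeanValue

variable {n : ℕ}

/-- The unnormalised radial weight `(1 - |z|²)₊ ^ k`. -/
def ballWeight {n : ℕ} (k : ℕ) (z : EuclideanSpace ℝ (Fin n)) : ℝ := max (1 - ‖z‖ ^ 2) 0 ^ k

lemma ballWeight_nonneg (k : ℕ) (z : EuclideanSpace ℝ (Fin n)) : 0 ≤ ballWeight k z := by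
  unfold ballWeight; positivity

lemma continuous_ballWeight (k : ℕ) : Continuous (ballWeight (n := n) k) := by
  unfold ballWeight; fun_prop

lemma ballWeight_eq_zero {k : ℕ} (hk : k ≠ 0) {z : EuclideanSpace ℝ (Fin n)} (hz : 1 ≤ ‖z‖) :
    ballWeight k z = 0 := by
  rw [ballWeight, max_eq_right (by nlinarith), zero_pow hk]

lemma hasCompactSupport_ballWeight {k : ℕ} (hk : k ≠ 0) :
    HasCompactSupport (ballWeight (n := n) k) :=
  HasCompactSupport.intro (isCompact_closedBall 0 1) fun z hz =>
    ballWeight_eq_zero hk (by simpa using (not_le.1 (mt mem_closedBall_zero_iff.2 hz)).le)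

lemma integrable_mul_ballWeight {k : ℕ} (hk : k ≠ 0) {g : EuclideanSpace ℝ (Fin n) → ℝ}
    (hg : Continuous g) : Integrable fun z => g z * ballWeight k z :=
  (hg.mul (continuous_ballWeight k)).integrable_of_hasCompactSupport
    (hasCompactSupport_ballWeight hk).mul_left

lemma integral_ballWeight_two_pos : 0 < ∫ z, ballWeight (n := n) 2 z := by
  refine (continuous_ballWeight 2).integral_pos_of_hasCompactSupport_nonneg_nonzero
    (hasCompactSupport_ballWeight two_ne_zero) (ballWeight_nonneg 2) (x := 0) ?_
  simp [ballWeight]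

lemma hasDerivAt_max_zero_cube (s : ℝ) :
    HasDerivAt (fun s : ℝ => max s 0 ^ 3) (3 * max s 0 ^ 2) s := by
  rcases lt_trichotomy s 0 with h | rfl | h
  · have : (fun s : ℝ => max s 0 ^ 3) =ᶠ[nhds s] fun _ => 0 := by
      filter_upwards [Iio_mem_nhds h] with r (hr : r < 0)
      simp [max_eq_right hr.le]
    simpa [max_eq_right h.le] using (hasDerivAt_const s (0 : ℝ)).congr_of_eventuallyEq this
  · rw [hasDerivAt_iff_isLittleO_nhds_zero]
    simp only [zero_add, max_self, ne_eq, OfNat.ofNat_ne_zero, not_false_eq_true, zero_pow,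
      mul_zero, sub_zero, smul_zero]
    refine Asymptotics.IsBigO.trans_isLittleO (g := fun h : ℝ => h ^ 3) ?_ ?_
    · refine Asymptotics.isBigO_of_le _ fun r => ?_
      rw [norm_pow, norm_pow]
      gcongr
      rw [Real.norm_eq_abs, Real.norm_eq_abs, abs_of_nonneg (le_max_right r 0)]
      exact max_le (le_abs_self r) (abs_nonneg r)
    · simpa using Asymptotics.isLittleO_pow_pow (𝕜 := ℝ) (show 1 < 3 by norm_num)
  · have : (fun s : ℝ => max s 0 ^ 3) =ᶠ[nhds s] fun s => s ^ 3 := by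
      filter_upwards [Ioi_mem_nhds h] with r (hr : 0 < r)
      simp [max_eq_left hr.le]
    simpa [max_eq_left h.le] using (hasDerivAt_pow 3 s).congr_of_eventuallyEq this

lemma hasFDerivAt_ballWeight_three (z : EuclideanSpace ℝ (Fin n)) :
    HasFDerivAt (ballWeight 3) ((-6 * ballWeight 2 z) • innerSL ℝ z) z := by
  have h1 : HasFDerivAt (fun z : EuclideanSpace ℝ (Fin n) => 1 - ‖z‖ ^ 2)
      (-(2 • innerSL ℝ z)) z := (hasStrictFDerivAt_norm_sq z).hasFDerivAt.const_sub 1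
  refine ((hasDerivAt_max_zero_cube (1 - ‖z‖ ^ 2)).comp_hasFDerivAt z h1).congr_fderiv ?_
  ext d
  simp [ballWeight]
  ring

/-- The weighted mean of `f` over the ball of radius `t` about `x`, up to normalisation. -/
def ballMean (f : EuclideanSpace ℝ (Fin n) → ℝ) (x : EuclideanSpace ℝ (Fin n)) (t : ℝ) : ℝ :=
  ∫ z, f (x + t • z) * ballWeight 2 z

variable {f : EuclideanSpace ℝ (Fin n) → ℝ}

lemma continuous_dirDeriv₂ (hf : ContDiff ℝ 2 f) (d : EuclideanSpace ℝ (Fin n)) :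
    Continuous fun x => dirDeriv₂ f x d := by
  have h : Continuous (iteratedFDeriv ℝ 2 f) := hf.continuous_iteratedFDeriv (by norm_num)
  unfold dirDeriv₂
  fun_prop

lemma continuous_lap (hf : ContDiff ℝ 2 f) : Continuous (lap f) :=
  continuous_finsetSum _ fun i _ => continuous_dirDeriv₂ hf (EuclideanSpace.single i 1)

lemma integral_fderiv_mul_ballWeight (hf : ContDiff ℝ 2 f) (x : EuclideanSpace ℝ (Fin n))
    (t : ℝ) : ∫ z, fderiv ℝ f (x + t • z) z * ballWeight 2 z =
      t / 6 * ∫ z, lap f (x + t • z) * ballWeight 3 z := by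
  have hf1 : ContDiff ℝ 1 (fderiv ℝ f) := hf.fderiv_right (by norm_num)
  set F : Fin n → EuclideanSpace ℝ (Fin n) → ℝ := fun i z =>
    fderiv ℝ f (x + t • z) (EuclideanSpace.single i 1) with hF
  have hFc (i : Fin n) : ContDiff ℝ 1 (F i) := by
    have : ContDiff ℝ 1 fun z : EuclideanSpace ℝ (Fin n) => x + t • z := by fun_prop
    exact (hf1.comp this).clm_apply contDiff_const
  have hcontF (i : Fin n) : Continuous (F i) := (hFc i).continuous
  have hcomp (z : EuclideanSpace ℝ (Fin n)) :
      fderiv ℝ f (x + t • z) z = ∑ i, F i z * ⟪z, EuclideanSpace.single i 1⟫ := by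
    have hlin (L : EuclideanSpace ℝ (Fin n) →L[ℝ] ℝ) :
        L z = ∑ i, L (EuclideanSpace.single i 1) * ⟪z, EuclideanSpace.single i 1⟫ := by
      conv_lhs => rw [← (EuclideanSpace.basisFun (Fin n) ℝ).sum_repr z, map_sum]
      simp [EuclideanSpace.inner_single_right, mul_comm]
    exact hlin _
  have hderivF (i : Fin n) (z : EuclideanSpace ℝ (Fin n)) :
      fderiv ℝ (F i) z (EuclideanSpace.single i 1) =
        t * dirDeriv₂ f (x + t • z) (EuclideanSpace.single i 1) := by
    have h1 : HasFDerivAt (fun z : EuclideanSpace ℝ (Fin n) => x + t • z)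
        (t • ContinuousLinearMap.id ℝ _) z := ((hasFDerivAt_id z).const_smul t).const_add x
    have h2 : DifferentiableAt ℝ (fun y => fderiv ℝ f y (EuclideanSpace.single i 1))
        (x + t • z) := (hf1.differentiable (by norm_num) _).clm_apply (differentiableAt_const _)
    have h3 := h2.hasFDerivAt.comp z h1
    have h4 : fderiv ℝ (F i) z = _ := h3.fderiv
    rw [← fderiv_fderiv_apply hf, h4]
    simp
  have hparts (i : Fin n) :
      ∫ z, F i z * ⟪z, EuclideanSpace.single i 1⟫ * ballWeight 2 z =
        t / 6 * ∫ z, dirDeriv₂ f (x + t • z) (EuclideanSpace.single i 1) * ballWeight 3 z := by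
    have hc2 : Continuous fun z => dirDeriv₂ f (x + t • z) (EuclideanSpace.single i 1) :=
      (continuous_dirDeriv₂ hf _).comp (by fun_prop)
    have hw (z : EuclideanSpace ℝ (Fin n)) :
        fderiv ℝ (ballWeight 3) z (EuclideanSpace.single i 1) =
          -6 * (⟪z, EuclideanSpace.single i 1⟫ * ballWeight 2 z) := by
      rw [(hasFDerivAt_ballWeight_three z).fderiv]
      simp only [_root_.smul_apply, innerSL_apply_apply, smul_eq_mul]
      ring
    have hinner : Continuous fun z : EuclideanSpace ℝ (Fin n) =>
        ⟪z, EuclideanSpace.single i (1 : ℝ)⟫ := by fun_prop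
    have h := integral_mul_fderiv_eq_neg_fderiv_mul_of_integrable (μ := volume) (f := F i)
      (g := ballWeight 3) (v := EuclideanSpace.single i 1) ?_ ?_
      (integrable_mul_ballWeight three_ne_zero (hcontF i))
      (fun z _ => (hFc i).differentiable (by norm_num) z)
      (fun z _ => (hasFDerivAt_ballWeight_three z).differentiableAt)
    · simp only [hw, hderivF] at h
      have e1 : ∫ z, F i z * (-6 * (⟪z, EuclideanSpace.single i 1⟫ * ballWeight 2 z)) =
          -6 * ∫ z, F i z * ⟪z, EuclideanSpace.single i 1⟫ * ballWeight 2 z := by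
        rw [← integral_const_mul]; congr 1; ext z; ring
      have e2 : ∫ z, t * dirDeriv₂ f (x + t • z) (EuclideanSpace.single i 1) * ballWeight 3 z =
          t * ∫ z, dirDeriv₂ f (x + t • z) (EuclideanSpace.single i 1) * ballWeight 3 z := by
        rw [← integral_const_mul]; congr 1; ext z; ring
      rw [e1, e2] at h
      linarith
    · simp only [hderivF]
      exact integrable_mul_ballWeight three_ne_zero (continuous_const.mul hc2)
    · simp only [hw]
      refine (integrable_mul_ballWeight two_ne_zero
        (continuous_const.mul ((hcontF i).mul hinner) : Continuous fun z =>
          (-6 : ℝ) * (F i z * ⟪z, EuclideanSpace.single i (1 : ℝ)⟫))).congr ?_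
      exact Filter.Eventually.of_forall fun z => by simp only [Pi.mul_apply]; ring
  have hint₂ (i : Fin n) : Integrable fun z =>
      F i z * ⟪z, EuclideanSpace.single i (1 : ℝ)⟫ * ballWeight 2 z :=
    integrable_mul_ballWeight (g := fun z => F i z * ⟪z, EuclideanSpace.single i (1 : ℝ)⟫)
      two_ne_zero ((hcontF i).mul (by fun_prop))
  have hint₃ (i : Fin n) : Integrable fun z =>
      dirDeriv₂ f (x + t • z) (EuclideanSpace.single i 1) * ballWeight 3 z :=
    integrable_mul_ballWeight three_ne_zero ((continuous_dirDeriv₂ hf _).comp (by fun_prop))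
  calc ∫ z, fderiv ℝ f (x + t • z) z * ballWeight 2 z
      = ∑ i, ∫ z, F i z * ⟪z, EuclideanSpace.single i 1⟫ * ballWeight 2 z := by
        rw [← integral_finsetSum _ fun i _ => hint₂ i]
        simp only [hcomp, Finset.sum_mul]
    _ = t / 6 * ∑ i, ∫ z, dirDeriv₂ f (x + t • z) (EuclideanSpace.single i 1) *
          ballWeight 3 z := by simp only [hparts, Finset.mul_sum]
    _ = t / 6 * ∫ z, lap f (x + t • z) * ballWeight 3 z := by
        rw [← integral_finsetSum _ fun i _ => hint₃ i]
        simp only [lap, dirDeriv₂, Finset.sum_mul]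

lemma hasDerivAt_ballMean (hf : ContDiff ℝ 2 f) (x : EuclideanSpace ℝ (Fin n)) (t : ℝ) :
    HasDerivAt (ballMean f x) (t / 6 * ∫ z, lap f (x + t • z) * ballWeight 3 z) t := by
  have hf1 : Continuous (fderiv ℝ f) := (hf.fderiv_right (m := 1) (by norm_num)).continuous
  have hcont : Continuous fun p : ℝ × EuclideanSpace ℝ (Fin n) =>
      fderiv ℝ f (x + p.1 • p.2) p.2 := (hf1.comp (by fun_prop)).clm_apply continuous_snd
  obtain ⟨B, hB⟩ := ((isCompact_Icc (a := t - 1) (b := t + 1)).prod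
    (isCompact_closedBall (0 : EuclideanSpace ℝ (Fin n)) 1)).exists_bound_of_continuousOn
    hcont.continuousOn
  have hfcont := hf.continuous
  rw [← integral_fderiv_mul_ballWeight hf]
  refine (hasDerivAt_integral_of_dominated_loc_of_deriv_le (μ := volume)
    (F := fun t z => f (x + t • z) * ballWeight 2 z)
    (F' := fun t z => fderiv ℝ f (x + t • z) z * ballWeight 2 z)
    (bound := fun z => B * ballWeight 2 z) (Icc_mem_nhds (sub_one_lt t) (lt_add_one t))
    (Filter.Eventually.of_forall fun s => ?_) ?_ ?_ (Filter.Eventually.of_forall ?_) ?_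
    (Filter.Eventually.of_forall ?_)).2
  · exact (integrable_mul_ballWeight two_ne_zero (by fun_prop)).aestronglyMeasurable
  · exact integrable_mul_ballWeight two_ne_zero (by fun_prop)
  · exact (integrable_mul_ballWeight two_ne_zero
      (hcont.comp (continuous_const.prodMk continuous_id))).aestronglyMeasurable
  · intro z s hs
    rw [norm_mul, Real.norm_of_nonneg (ballWeight_nonneg 2 z)]
    rcases le_or_gt 1 ‖z‖ with hz | hz
    · simp [ballWeight_eq_zero two_ne_zero hz]
    · exact mul_le_mul_of_nonneg_right (hB (s, z) ⟨hs, by simpa using hz.le⟩)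
        (ballWeight_nonneg 2 z)
  · exact integrable_mul_ballWeight two_ne_zero continuous_const
  · intro z s _
    exact (hasDerivAt_comp_line hf x z s).mul_const _

lemma ballMean_zero (f : EuclideanSpace ℝ (Fin n) → ℝ) (x : EuclideanSpace ℝ (Fin n)) :
    ballMean f x 0 = f x * ∫ z, ballWeight (n := n) 2 z := by
  simp [ballMean, integral_const_mul]

/-- Sub-mean value inequality. -/
lemma mul_integral_ballWeight_le_ballMean (hf : ContDiff ℝ 2 f) (hlap : ∀ y, 0 ≤ lap f y)
    (x : EuclideanSpace ℝ (Fin n)) :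
    f x * ∫ z, ballWeight (n := n) 2 z ≤ ballMean f x 1 := by
  rw [← ballMean_zero]
  have hmono : MonotoneOn (ballMean f x) (Set.Icc 0 1) := by
    refine monotoneOn_of_deriv_nonneg (convex_Icc 0 1)
      (fun t _ => (hasDerivAt_ballMean hf x t).continuousAt.continuousWithinAt)
      (fun t _ => (hasDerivAt_ballMean hf x t).differentiableAt.differentiableWithinAt) ?_
    intro t ht
    rw [interior_Icc] at ht
    rw [(hasDerivAt_ballMean hf x t).deriv]
    exact mul_nonneg (by linarith [ht.1]) (integral_nonneg fun z =>
      mul_nonneg (hlap _) (ballWeight_nonneg 3 z))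
  exact hmono (by simp) (by simp) zero_le_one

/-- Reverse mean value inequality for positive functions with `Δf ≤ Λ f`. -/
lemma ballMean_two_le (hf : ContDiff ℝ 2 f) (hpos : ∀ y, 0 ≤ f y) {Λ : ℝ} (hΛ : 0 ≤ Λ)
    {x : EuclideanSpace ℝ (Fin n)} (hlap : ∀ y ∈ closedBall x 2, lap f y ≤ Λ * f y) :
    ballMean f x 2 ≤ Real.exp (2 * Λ) * (f x * ∫ z, ballWeight (n := n) 2 z) := by
  have hfcont := hf.continuous
  have hlcont := continuous_lap hf
  have hder (t : ℝ) : HasDerivAt (fun t => Real.exp (-Λ * t) * ballMean f x t)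
      (Real.exp (-Λ * t) * (t / 6 * (∫ z, lap f (x + t • z) * ballWeight 3 z) -
        Λ * ballMean f x t)) t := by
    have h1 : HasDerivAt (fun t : ℝ => Real.exp (-Λ * t)) (Real.exp (-Λ * t) * (-Λ)) t := by
      simpa using ((hasDerivAt_id t).const_mul (-Λ)).exp
    refine (h1.mul (hasDerivAt_ballMean hf x t)).congr_deriv ?_
    ring
  have hanti : AntitoneOn (fun t => Real.exp (-Λ * t) * ballMean f x t) (Set.Icc 0 2) := by
    refine antitoneOn_of_deriv_nonpos (convex_Icc 0 2)
      (fun t _ => (hder t).continuousAt.continuousWithinAt)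
      (fun t _ => (hder t).differentiableAt.differentiableWithinAt) ?_
    intro t ht
    rw [interior_Icc] at ht
    rw [(hder t).deriv]
    refine mul_nonpos_of_nonneg_of_nonpos (Real.exp_pos _).le ?_
    have hpt : ∫ z, lap f (x + t • z) * ballWeight 3 z ≤ Λ * ballMean f x t := by
      rw [ballMean, ← integral_const_mul]
      refine integral_mono (integrable_mul_ballWeight three_ne_zero (by fun_prop))
        ((integrable_mul_ballWeight two_ne_zero (by fun_prop)).const_mul Λ) fun z => ?_
      rcases le_or_gt 1 ‖z‖ with hz | hz
      · simp [ballWeight_eq_zero two_ne_zero hz, ballWeight_eq_zero three_ne_zero hz]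
      · have hmem : x + t • z ∈ closedBall x 2 := by
          rw [mem_closedBall, dist_eq_norm, add_sub_cancel_left, norm_smul, Real.norm_eq_abs,
            abs_of_pos ht.1]
          nlinarith [ht.1, ht.2, norm_nonneg z]
        have hw : ballWeight 3 z ≤ ballWeight 2 z := by
          refine pow_le_pow_of_le_one (le_max_right _ _) (max_le ?_ zero_le_one) (by norm_num)
          linarith [sq_nonneg ‖z‖]
        calc lap f (x + t • z) * ballWeight 3 z
            ≤ (Λ * f (x + t • z)) * ballWeight 3 z :=
              mul_le_mul_of_nonneg_right (hlap _ hmem) (ballWeight_nonneg 3 z)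
          _ ≤ (Λ * f (x + t • z)) * ballWeight 2 z :=
              mul_le_mul_of_nonneg_left hw (mul_nonneg hΛ (hpos _))
          _ = Λ * (f (x + t • z) * ballWeight 2 z) := by ring
    have hM : 0 ≤ Λ * ballMean f x t := mul_nonneg hΛ
      (integral_nonneg fun z => mul_nonneg (hpos _) (ballWeight_nonneg 2 z))
    nlinarith [ht.1, ht.2]
  have h := hanti (show (0 : ℝ) ∈ Set.Icc 0 2 by simp) (show (2 : ℝ) ∈ Set.Icc 0 2 by simp)
    zero_le_two
  simp only [mul_zero, Real.exp_zero, one_mul, ballMean_zero] at h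
  calc ballMean f x 2 = Real.exp (2 * Λ) * (Real.exp (-Λ * 2) * ballMean f x 2) := by
        rw [← mul_assoc, ← Real.exp_add]; simp [mul_comm]
    _ ≤ _ := mul_le_mul_of_nonneg_left h (Real.exp_pos _).le

/-- Comparison of weighted means over balls with nearby centres. -/
lemma ballMean_one_le (hf : Continuous f) (hpos : ∀ y, 0 ≤ f y)
    {x y : EuclideanSpace ℝ (Fin n)} (hxy : dist x y ≤ 1 / 2) :
    ballMean f y 1 ≤ 2 ^ n * 6 * ballMean f x 2 := by
  set G : EuclideanSpace ℝ (Fin n) → ℝ := fun w => f (x + w) * ballWeight 2 ((2⁻¹ : ℝ) • w)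
    with hG
  have h1 : ballMean f x 2 = (2 ^ n)⁻¹ * ∫ w, G w := by
    have h := Measure.integral_comp_smul (volume : Measure (EuclideanSpace ℝ (Fin n))) G 2
    rw [finrank_euclideanSpace_fin, abs_of_pos (by positivity), smul_eq_mul] at h
    rw [← h, ballMean]
    simp [hG, smul_smul]
  have hcw := continuous_ballWeight (n := n) 2
  have hGsupp : HasCompactSupport fun w : EuclideanSpace ℝ (Fin n) =>
      ballWeight 2 ((2⁻¹ : ℝ) • w) :=
    HasCompactSupport.intro (isCompact_closedBall 0 2) fun w hw => by
      refine ballWeight_eq_zero two_ne_zero ?_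
      rw [mem_closedBall_zero_iff, not_le] at hw
      rw [norm_smul]; norm_num; linarith
  have hGint : Integrable G :=
    Continuous.integrable_of_hasCompactSupport (by fun_prop) hGsupp.mul_left
  have h2 : ∫ w, G (w + (y - x)) = ∫ w, G w := integral_add_right_eq_self G (y - x)
  have h3 : ballMean f y 1 ≤ 6 * ∫ w, G (w + (y - x)) := by
    rw [ballMean, ← integral_const_mul]
    refine integral_mono (integrable_mul_ballWeight two_ne_zero (by fun_prop))
      ((hGint.comp_add_right (y - x)).const_mul 6) fun w => ?_
    have e : x + (w + (y - x)) = y + w := by abel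
    simp only [one_smul, hG, e]
    have hw : ballWeight 2 w ≤ 6 * ballWeight 2 ((2⁻¹ : ℝ) • (w + (y - x))) := by
      rcases le_or_gt 1 ‖w‖ with hz | hz
      · rw [ballWeight_eq_zero two_ne_zero hz]
        exact mul_nonneg (by norm_num) (ballWeight_nonneg _ _)
      · have hn : ‖(2⁻¹ : ℝ) • (w + (y - x))‖ ≤ 3 / 4 := by
          rw [norm_smul]
          have := norm_add_le w (y - x)
          rw [dist_comm, dist_eq_norm] at hxy
          norm_num; linarith
        have ha : ballWeight 2 w ≤ 1 := by
          refine pow_le_one₀ (le_max_right _ _) (max_le ?_ zero_le_one)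
          linarith [sq_nonneg ‖w‖]
        have hb : (7 / 16 : ℝ) ^ 2 ≤ ballWeight 2 ((2⁻¹ : ℝ) • (w + (y - x))) := by
          refine pow_le_pow_left₀ (by norm_num) (le_max_of_le_left ?_) 2
          nlinarith [norm_nonneg ((2⁻¹ : ℝ) • (w + (y - x)))]
        linarith
    calc f (y + w) * ballWeight 2 w
        ≤ f (y + w) * (6 * ballWeight 2 ((2⁻¹ : ℝ) • (w + (y - x)))) :=
          mul_le_mul_of_nonneg_left hw (hpos _)
      _ = _ := by ring
  rw [h1]
  calc ballMean f y 1 ≤ 6 * ∫ w, G w := by rw [← h2]; exact h3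
    _ = _ := by field_simp

/-- A Harnack inequality for nonnegative subharmonic functions with `Δf ≤ Λ f`. -/
lemma harnack (hf : ContDiff ℝ 2 f) (hpos : ∀ y, 0 ≤ f y) (hsub : ∀ y, 0 ≤ lap f y)
    {Λ : ℝ} (hΛ : 0 ≤ Λ) {x y : EuclideanSpace ℝ (Fin n)} (hxy : dist x y ≤ 1 / 2)
    (hlap : ∀ z ∈ closedBall x 2, lap f z ≤ Λ * f z) :
    f y ≤ 2 ^ n * 6 * Real.exp (2 * Λ) * f x := by
  have h1 := mul_integral_ballWeight_le_ballMean hf hsub y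
  have h2 := ballMean_one_le hf.continuous hpos hxy
  have h3 := mul_le_mul_of_nonneg_left (ballMean_two_le hf hpos hΛ hlap)
    (show (0 : ℝ) ≤ 2 ^ n * 6 by positivity)
  refine le_of_mul_le_mul_right ?_ (integral_ballWeight_two_pos (n := n))
  linarith

end MeanValue

section Products

variable {n : ℕ} {f g : EuclideanSpace ℝ (Fin n) → ℝ}

lemma hasDerivAt_mul_comp_line_sub (hf : ContDiff ℝ 2 f) (hg : ContDiff ℝ 2 g)
    (x d y e : EuclideanSpace ℝ (Fin n)) (m a b c t : ℝ) :
    HasDerivAt (fun t : ℝ => f (x + t • d) * g (y + t • e) - m * (a + b * t + c * t ^ 2) ^ 2)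
      (fderiv ℝ f (x + t • d) d * g (y + t • e) + f (x + t • d) * fderiv ℝ g (y + t • e) e -
        m * (2 * (a + b * t + c * t ^ 2) * (b + 2 * c * t))) t := by
  have h1 := (hasDerivAt_id t).const_mul b
  have h2 := ((hasDerivAt_id t).pow 2).const_mul c
  refine ((hasDerivAt_comp_line hf x d t).mul (hasDerivAt_comp_line hg y e t)).sub
    ((((h1.const_add a).add h2).pow 2).const_mul m |>.congr_deriv ?_)
  simp only [id_eq, Pi.add_apply, Pi.pow_apply, Nat.cast_ofNat, Nat.add_one_sub_one, pow_one,
    mul_one]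
  ring

lemma mul_line_conditions_of_isLocalMax (hf : ContDiff ℝ 2 f) (hg : ContDiff ℝ 2 g)
    {x d y e : EuclideanSpace ℝ (Fin n)} {m a b c : ℝ}
    (hmax : IsLocalMax
      (fun t : ℝ => f (x + t • d) * g (y + t • e) - m * (a + b * t + c * t ^ 2) ^ 2) 0) :
    fderiv ℝ f x d * g y + f x * fderiv ℝ g y e = 2 * m * a * b ∧
      dirDeriv₂ f x d * g y + 2 * (fderiv ℝ f x d * fderiv ℝ g y e) + f x * dirDeriv₂ g y e ≤
        m * (2 * b ^ 2 + 4 * a * c) := by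
  have h1 := hasDerivAt_mul_comp_line_sub hf hg x d y e m a b c
  constructor
  · have h2 := hmax.hasDerivAt_eq_zero (h1 0)
    simp only [zero_smul, add_zero, mul_zero, ne_eq, OfNat.ofNat_ne_zero, not_false_eq_true,
      zero_pow] at h2
    linarith
  · have h3 := hasDerivAt_fderiv_comp_line hf x d 0
    have h4 := hasDerivAt_fderiv_comp_line hg y e 0
    have h5 := hasDerivAt_comp_line hf x d 0
    have h6 := hasDerivAt_comp_line hg y e 0
    have h7 : HasDerivAt (fun t : ℝ => a + b * t + c * t ^ 2) b 0 := by
      refine ((((hasDerivAt_id (0 : ℝ)).const_mul b).const_add a).add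
        (((hasDerivAt_id (0 : ℝ)).pow 2).const_mul c)).congr_deriv ?_
      simp
    have h8 : HasDerivAt (fun t : ℝ => b + 2 * c * t) (2 * c) 0 := by
      refine (((hasDerivAt_id (0 : ℝ)).const_mul (2 * c)).const_add b).congr_deriv ?_
      simp
    have h9 := hmax.second_deriv_nonpos h1
      (((h3.mul h6).add (h5.mul h4)).sub (((h7.const_mul 2).mul h8).const_mul m))
    simp only [zero_smul, add_zero, mul_zero, ne_eq, OfNat.ofNat_ne_zero, not_false_eq_true,
      zero_pow] at h9
    linarith

end Products

/-- The weight by which the two-point product `u x * v y` is normalised. -/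
def twoPointWeight {n : ℕ} (δ ε : ℝ) (x y : EuclideanSpace ℝ (Fin n)) : ℝ :=
  1 + ‖x - y‖ - δ * ‖x - y‖ ^ 2 + ε * (‖x‖ ^ 2 + ‖y‖ ^ 2)

section TwoPoint

variable {n : ℕ} {u v : EuclideanSpace ℝ (Fin n) → ℝ}

lemma continuous_twoPointWeight (δ ε : ℝ) :
    Continuous fun z : EuclideanSpace ℝ (Fin n) × EuclideanSpace ℝ (Fin n) =>
      twoPointWeight δ ε z.1 z.2 := by
  unfold twoPointWeight
  fun_prop

/-- `(x, y)` is a local maximum point, with value `m`, of `u x * v y / twoPointWeight x y ^ 2`. -/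
structure IsTwoPointMax (u v : EuclideanSpace ℝ (Fin n) → ℝ) (δ ε m : ℝ)
    (x y : EuclideanSpace ℝ (Fin n)) : Prop where
  nonneg : 0 ≤ m
  eq : u x * v y = m * twoPointWeight δ ε x y ^ 2
  le : ∀ᶠ z in nhds (x, y), u z.1 * v z.2 ≤ m * twoPointWeight δ ε z.1 z.2 ^ 2
  pos : 0 < twoPointWeight δ ε x y

namespace IsTwoPointMax

variable {δ ε m : ℝ} {x y : EuclideanSpace ℝ (Fin n)}

lemma eventually_line (h : IsTwoPointMax u v δ ε m x y) (d e : EuclideanSpace ℝ (Fin n)) :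
    ∀ᶠ t : ℝ in nhds 0, u (x + t • d) * v (y + t • e) ≤
      m * twoPointWeight δ ε (x + t • d) (y + t • e) ^ 2 ∧
      0 < twoPointWeight δ ε (x + t • d) (y + t • e) := by
  have hpos : ∀ᶠ z : EuclideanSpace ℝ (Fin n) × EuclideanSpace ℝ (Fin n) in nhds (x, y),
      0 < twoPointWeight δ ε z.1 z.2 :=
    (continuous_twoPointWeight δ ε).continuousAt.eventually (lt_mem_nhds h.pos)
  have hc : Filter.Tendsto (fun t : ℝ => (x + t • d, y + t • e)) (nhds 0) (nhds (x, y)) := by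
    have : Continuous fun t : ℝ => (x + t • d, y + t • e) := by fun_prop
    simpa using this.tendsto 0
  exact hc.eventually (h.le.and hpos)

lemma le_of_norm_le (h : IsTwoPointMax u v δ ε m x y) {d e : EuclideanSpace ℝ (Fin n)}
    {b c t : ℝ} (hle : u (x + t • d) * v (y + t • e) ≤
      m * twoPointWeight δ ε (x + t • d) (y + t • e) ^ 2)
    (hpos : 0 < twoPointWeight δ ε (x + t • d) (y + t • e))
    (hnorm : ‖x - y + t • (d - e)‖ ≤ ‖x - y‖ + b * t + c * t ^ 2) :
    u (x + t • d) * v (y + t • e) ≤ m * (twoPointWeight δ ε x y +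
      (b - 2 * δ * ⟪x - y, d - e⟫ + 2 * ε * (⟪x, d⟫ + ⟪y, e⟫)) * t +
      (c - δ * ‖d - e‖ ^ 2 + ε * (‖d‖ ^ 2 + ‖e‖ ^ 2)) * t ^ 2) ^ 2 := by
  refine hle.trans (mul_le_mul_of_nonneg_left (pow_le_pow_left₀ hpos.le ?_ 2) h.nonneg)
  have hsub : x + t • d - (y + t • e) = x - y + t • (d - e) := by module
  rw [twoPointWeight, twoPointWeight, hsub, norm_add_smul_sq (x - y), norm_add_smul_sq x,
    norm_add_smul_sq y]
  linarith

lemma line_conditions (h : IsTwoPointMax u v δ ε m x y) (hu : ContDiff ℝ 2 u)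
    (hv : ContDiff ℝ 2 v) {d e : EuclideanSpace ℝ (Fin n)} {b c : ℝ}
    (hnorm : ∀ᶠ t : ℝ in nhds 0, ‖x - y + t • (d - e)‖ ≤ ‖x - y‖ + b * t + c * t ^ 2) :
    fderiv ℝ u x d * v y + u x * fderiv ℝ v y e = 2 * m * twoPointWeight δ ε x y *
      (b - 2 * δ * ⟪x - y, d - e⟫ + 2 * ε * (⟪x, d⟫ + ⟪y, e⟫)) ∧
    dirDeriv₂ u x d * v y + 2 * (fderiv ℝ u x d * fderiv ℝ v y e) + u x * dirDeriv₂ v y e ≤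
      m * (2 * (b - 2 * δ * ⟪x - y, d - e⟫ + 2 * ε * (⟪x, d⟫ + ⟪y, e⟫)) ^ 2 +
        4 * twoPointWeight δ ε x y * (c - δ * ‖d - e‖ ^ 2 + ε * (‖d‖ ^ 2 + ‖e‖ ^ 2))) := by
  refine mul_line_conditions_of_isLocalMax hu hv ?_
  filter_upwards [hnorm, h.eventually_line d e] with t h1 h2
  have h3 := h.le_of_norm_le h2.1 h2.2 h1
  have h4 := h.eq
  simp only [zero_smul, add_zero, mul_zero, ne_eq, OfNat.ofNat_ne_zero, not_false_eq_true,
    zero_pow]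
  linarith

lemma norm_add_le_of_ne {w d : EuclideanSpace ℝ (Fin n)} (hw : w ≠ 0) (t : ℝ) :
    ‖w + t • d‖ ≤ ‖w‖ + ⟪w, d⟫ / ‖w‖ * t + ‖d‖ ^ 2 / (2 * ‖w‖) * t ^ 2 := by
  have h0 : 0 < ‖w‖ := norm_pos_iff.2 hw
  have h1 := norm_add_smul_sq w d t
  have h2 : ‖w‖ + ⟪w, d⟫ / ‖w‖ * t + ‖d‖ ^ 2 / (2 * ‖w‖) * t ^ 2 =
      (‖w‖ ^ 2 + ‖w + t • d‖ ^ 2) / (2 * ‖w‖) := by rw [h1]; field_simp; ring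
  rw [h2, le_div_iff₀ (by positivity)]
  nlinarith [sq_nonneg (‖w + t • d‖ - ‖w‖)]

/-- No two-point maximum off the diagonal. -/
lemma eq_of_lap_pos (h : IsTwoPointMax u v δ ε m x y) (hu : ContDiff ℝ 2 u)
    (hv : ContDiff ℝ 2 v) (hux : 0 < u x) (hvy : 0 < v y)
    (hlapu : 0 < lap u x) (hlapv : 0 < lap v y) (hε : 0 < ε) (hδ : δ = (n + 2) * ε / 2)
    (hφ : ε * (‖x‖ ^ 2 + ‖y‖ ^ 2) ≤ twoPointWeight δ ε x y) : x = y := by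
  by_contra hne
  set φ := twoPointWeight δ ε x y with hφdef
  have hw : x - y ≠ 0 := sub_ne_zero.2 hne
  set r := ‖x - y‖ with hr
  have hr0 : 0 < r := norm_pos_iff.2 hw
  obtain ⟨e, he⟩ : ∃ e, e = r⁻¹ • (x - y) := ⟨_, rfl⟩
  have hxy : x - y = r • e := by rw [he, smul_smul, mul_inv_cancel₀ hr0.ne', one_smul]
  have hnorm : ‖e‖ = 1 := by
    rw [he, norm_smul, norm_inv, norm_norm, ← hr, inv_mul_cancel₀ hr0.ne']
  have hee : ⟪e, e⟫ = (1 : ℝ) := by rw [real_inner_self_eq_norm_sq, hnorm]; norm_num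
  obtain ⟨σ, hσ⟩ := exists_reflection hnorm
  have hσadj (z w : EuclideanSpace ℝ (Fin n)) : ⟪z, σ w⟫ = ⟪σ z, w⟫ := by
    rw [hσ, hσ, inner_sub_right, inner_sub_left, inner_smul_right, real_inner_smul_left,
      real_inner_comm z e]
    ring
  have hσe : σ e = -e := by rw [hσ, hee]; module
  set B := EuclideanSpace.basisFun (Fin n) ℝ with hB
  have hBn (i : Fin n) : ‖B i‖ = 1 := B.orthonormal.1 i
  have hφ0 : 0 < φ := h.pos
  have hm : 0 < m := by
    refine h.nonneg.lt_of_ne fun h0 => ?_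
    have := h.eq
    rw [← h0, zero_mul] at this
    exact (mul_pos hux hvy).ne' this
  have hdir (d : EuclideanSpace ℝ (Fin n)) (hd : ‖d‖ = 1) :
      dirDeriv₂ u x d * v y + u x * dirDeriv₂ v y (σ d) ≤
      m * (8 * ε ^ 2 * ⟪x - σ y, d⟫ ^ 2 + 4 * φ * (2 * ε - 4 * δ * ⟪e, d⟫ ^ 2)) := by
    set τ : ℝ := ⟪e, d⟫ with hτ
    have h1 := (h.line_conditions hu hv (d := d) (e := 0) (Filter.Eventually.of_forall fun t => by
      simpa using norm_add_le_of_ne (d := d) hw t)).1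
    have h2 := (h.line_conditions hu hv (d := 0) (e := σ d) (Filter.Eventually.of_forall fun t => by
      simpa only [zero_sub] using norm_add_le_of_ne (d := -σ d) hw t)).1
    have hsub : d - σ d = (2 * τ) • e := by rw [hσ]; module
    have hlin : ∀ᶠ t : ℝ in nhds 0, ‖x - y + t • (d - σ d)‖ ≤ ‖x - y‖ + 2 * τ * t + 0 * t ^ 2 := by
      have hc : Continuous fun t : ℝ => r + 2 * τ * t := by fun_prop
      have : ∀ᶠ t : ℝ in nhds 0, 0 < r + 2 * τ * t :=
        hc.continuousAt.eventually (lt_mem_nhds (by simpa using hr0))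
      filter_upwards [this] with t ht
      have : x - y + t • (d - σ d) = (r + 2 * τ * t) • e := by rw [hsub, hxy]; module
      rw [this, norm_smul, hnorm, Real.norm_of_nonneg ht.le, ← hr]
      linarith
    have h3 := (h.line_conditions hu hv hlin).2
    rw [hsub] at h3
    rw [hxy] at h1 h2 h3
    simp only [sub_zero, zero_sub, map_zero, mul_zero, zero_mul, add_zero, zero_add,
      inner_zero_right, inner_neg_right, inner_smul_right, real_inner_smul_left, norm_smul, hnorm,
      mul_one, hσadj, map_smul, hσe, inner_neg_left, ← hτ, hee, LinearIsometryEquiv.norm_map,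
      ← hφdef, Real.norm_eq_abs, abs_of_pos hr0, hd] at h1 h2 h3
    have e1 : r * τ / r = τ := by field_simp
    have e2 : -(r * -τ) / r = τ := by field_simp
    rw [e1] at h1
    rw [e2] at h2
    rw [inner_sub_left]
    set a := ⟪x, d⟫
    set b := ⟪σ y, d⟫
    set X := τ - 2 * δ * (r * τ) + 2 * ε * a with hX
    set Y := τ - 2 * δ * (r * τ) + 2 * ε * b with hY
    set p := fderiv ℝ u x d
    set q := fderiv ℝ v y (σ d)
    have h4 : p * q = 4 * m * (X * Y) := by
      have h5 : m * φ ^ 2 * (p * q) = m * φ ^ 2 * (4 * m * (X * Y)) := by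
        calc m * φ ^ 2 * (p * q) = (p * v y) * (u x * q) := by rw [← h.eq]; ring
          _ = (2 * m * φ * X) * (2 * m * φ * Y) := by rw [h1, h2]; congr 2; rw [hY]; ring
          _ = _ := by ring
      exact mul_left_cancel₀ (by positivity) h5
    have h6 : |2 * τ| ^ 2 = 4 * τ ^ 2 := by rw [sq_abs]; ring
    rw [h4, h6] at h3
    calc _ ≤ m * (2 * (2 * τ - 2 * δ * (2 * τ * r) + 2 * ε * (a + b)) ^ 2 +
          4 * φ * (-(δ * (4 * τ ^ 2)) + ε * (1 ^ 2 + 1 ^ 2))) - 2 * (4 * m * (X * Y)) := by linarith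
      _ = _ := by rw [hX, hY]; ring
  have hsum : lap u x * v y + u x * lap v y ≤
      m * (8 * ε ^ 2 * ‖x - σ y‖ ^ 2 + 4 * φ * (2 * n * ε - 4 * δ)) := by
    rw [lap_eq_sum_dirDeriv₂ u x B, lap_eq_sum_dirDeriv₂ v y (B.map σ), Finset.sum_mul,
      Finset.mul_sum, ← Finset.sum_add_distrib]
    refine (Finset.sum_le_sum fun i _ => by simpa using hdir _ (hBn i)).trans_eq ?_
    simp only [← Finset.mul_sum, Finset.sum_add_distrib, Finset.sum_sub_distrib,
      B.sum_sq_inner_left, hnorm, Finset.sum_const, Finset.card_univ, Fintype.card_fin,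
      nsmul_eq_mul]
    ring
  have hlap : 0 < lap u x * v y + u x * lap v y := by positivity
  have h1 := pos_of_mul_pos_right (hlap.trans_le hsum) hm.le
  have h2 : ‖x - σ y‖ ^ 2 ≤ 2 * (‖x‖ ^ 2 + ‖y‖ ^ 2) := by
    have h3 := norm_sub_le x (σ y)
    rw [σ.norm_map] at h3
    nlinarith [sq_nonneg (‖x‖ - ‖y‖), norm_nonneg (x - σ y)]
  have h3 : 8 * ε ^ 2 * ‖x - σ y‖ ^ 2 ≤ 16 * ε * φ :=
    calc 8 * ε ^ 2 * ‖x - σ y‖ ^ 2 ≤ 8 * ε ^ 2 * (2 * (‖x‖ ^ 2 + ‖y‖ ^ 2)) := by gcongr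
      _ = 16 * ε * (ε * (‖x‖ ^ 2 + ‖y‖ ^ 2)) := by ring
      _ ≤ _ := by gcongr
  rw [hδ] at h1
  linarith

/-- The bound at a two-point maximum on the diagonal. -/
lemma le_of_diagonal {z : EuclideanSpace ℝ (Fin n)} (h : IsTwoPointMax u v δ ε m z z)
    (hu : ContDiff ℝ 2 u) (hv : ContDiff ℝ 2 v) (hlapu : lap u z = u z * v z ^ 2)
    (hlapv : lap v z = v z * u z ^ 2) (hm : 0 < m)
    (hε : n * ε ≤ 1) (hφ : 1 ≤ twoPointWeight δ ε z z) : m ≤ 8 := by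
  set φ := twoPointWeight δ ε z z with hφdef
  set B := EuclideanSpace.basisFun (Fin n) ℝ with hB
  have hBn (i : Fin n) : ‖B i‖ = 1 := B.orthonormal.1 i
  have hφ0 : 0 < φ := h.pos
  set D := v z • gradient u z - u z • gradient v z with hD
  have hDd (d : EuclideanSpace ℝ (Fin n)) :
      ⟪D, d⟫ = fderiv ℝ u z d * v z - u z * fderiv ℝ v z d := by
    rw [hD, inner_sub_left, real_inner_smul_left, real_inner_smul_left, inner_gradient_left,
      inner_gradient_left]
    ring
  have hdir (d : EuclideanSpace ℝ (Fin n)) (hd : ‖d‖ = 1) :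
      dirDeriv₂ u z d * v z + u z * dirDeriv₂ v z d ≤
        8 * m * φ * ε + ⟪D, d⟫ ^ 2 / (2 * m * φ ^ 2) := by
    have h1 := h.line_conditions hu hv (d := d) (e := d) (b := 0) (c := 0)
      (Filter.Eventually.of_forall fun t => by simp)
    rw [hDd]
    simp only [sub_self, norm_zero, inner_zero_right, hd, ← hφdef] at h1
    obtain ⟨h1, h2⟩ := h1
    have h3 : (fderiv ℝ u z d * v z - u z * fderiv ℝ v z d) ^ 2 / (2 * m * φ ^ 2) =
        2 * m * (2 * ε * (⟪z, d⟫ + ⟪z, d⟫)) ^ 2 - 2 * (fderiv ℝ u z d * fderiv ℝ v z d) := by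
      have h4 : (fderiv ℝ u z d * v z - u z * fderiv ℝ v z d) ^ 2 =
          (fderiv ℝ u z d * v z + u z * fderiv ℝ v z d) ^ 2 -
            4 * (u z * v z) * (fderiv ℝ u z d * fderiv ℝ v z d) := by ring
      rw [div_eq_iff (by positivity), h4, h1, h.eq, ← hφdef]
      ring
    rw [h3]
    linarith
  have hDn : ‖D‖ ≤ 4 * m * φ := by
    have h1 := hasDerivAt_mul_comp_line_sub hu hv z D z (-D) m φ (2 * ‖D‖)
      (0 - δ * ‖D - -D‖ ^ 2 + ε * (‖D‖ ^ 2 + ‖-D‖ ^ 2)) 0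
    have hmax : IsLocalMaxOn (fun t : ℝ => u (z + t • D) * v (z + t • (-D)) - m * (φ +
        2 * ‖D‖ * t + (0 - δ * ‖D - -D‖ ^ 2 + ε * (‖D‖ ^ 2 + ‖-D‖ ^ 2)) * t ^ 2) ^ 2)
        (Set.Ici 0) 0 := by
      filter_upwards [(h.eventually_line D (-D)).filter_mono nhdsWithin_le_nhds,
        self_mem_nhdsWithin] with t ht (ht0 : 0 ≤ t)
      have h2 := h.le_of_norm_le (b := 2 * ‖D‖) (c := 0) ht.1 ht.2 (by
        rw [sub_self, zero_add, norm_smul, Real.norm_of_nonneg ht0, sub_neg_eq_add, ← two_smul ℝ,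
          norm_smul]
        norm_num
        linarith)
      have h3 := h.eq
      simp only [sub_self, inner_zero_left, inner_neg_right, add_neg_cancel, mul_zero, sub_zero,
        add_zero, ← hφdef] at h2
      simp only [zero_smul, add_zero, mul_zero, ne_eq, OfNat.ofNat_ne_zero, not_false_eq_true,
        zero_pow]
      linarith
    have h4 := hmax.hasFDerivWithinAt_nonpos h1.hasFDerivAt.hasFDerivWithinAt
      (y := 1) (mem_posTangentConeAt_of_segment_subset (by
        rw [zero_add, segment_eq_Icc zero_le_one]
        exact fun t ht => ht.1))
    have h5 := hDd D
    rw [real_inner_self_eq_norm_sq] at h5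
    simp at h4
    rcases (norm_nonneg D).eq_or_lt with h0 | h0
    · rw [← h0]; positivity
    · exact le_of_mul_le_mul_left (by linarith) h0
  have hsum : lap u z * v z + u z * lap v z ≤
      8 * n * m * φ * ε + ‖D‖ ^ 2 / (2 * m * φ ^ 2) := by
    rw [lap_eq_sum_dirDeriv₂ u z B, lap_eq_sum_dirDeriv₂ v z B, Finset.sum_mul,
      Finset.mul_sum, ← Finset.sum_add_distrib]
    refine (Finset.sum_le_sum fun i _ => hdir _ (hBn i)).trans_eq ?_
    rw [Finset.sum_add_distrib, ← Finset.sum_div, B.sum_sq_inner_left]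
    simp
    ring
  have h1 : ‖D‖ ^ 2 / (2 * m * φ ^ 2) ≤ 8 * m := by
    rw [div_le_iff₀ (by positivity)]
    calc ‖D‖ ^ 2 ≤ (4 * m * φ) ^ 2 := by gcongr
      _ = _ := by ring
  have h2 : lap u z * v z + u z * lap v z = (m * φ ^ 2) * (u z ^ 2 + v z ^ 2) := by
    rw [← h.eq, hlapu, hlapv]; ring
  have h3 : 2 * (m * φ ^ 2) ≤ u z ^ 2 + v z ^ 2 := by
    rw [← h.eq]; linarith [sq_nonneg (u z - v z)]
  have h4 : m * φ ^ 2 * (2 * (m * φ ^ 2)) ≤ m * φ ^ 2 * (u z ^ 2 + v z ^ 2) := by gcongr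
  have h5 : 8 * n * m * φ * ε ≤ 8 * m * φ :=
    calc 8 * n * m * φ * ε = 8 * m * φ * (n * ε) := by ring
      _ ≤ 8 * m * φ * 1 := by gcongr
      _ = _ := by ring
  have h6 : m * (2 * m * φ ^ 4) ≤ m * (16 * φ) := by nlinarith
  have h7 := le_of_mul_le_mul_left h6 hm
  have h8 : m * φ ^ 3 ≤ 8 := by
    refine le_of_mul_le_mul_left ?_ hφ0
    linarith
  calc m = m * 1 := by ring
    _ ≤ m * φ ^ 3 := by gcongr; exact one_le_pow₀ hφ
    _ ≤ 8 := h8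

end IsTwoPointMax

lemma IsSolution.symm (hsol : IsSolution u v) : IsSolution v u :=
  let ⟨hu, hv, hupos, hvpos, hlapu, hlapv⟩ := hsol
  ⟨hv, hu, hvpos, hupos, hlapv, hlapu⟩

lemma IsSolution.contDiff_two (hsol : IsSolution u v) : ContDiff ℝ 2 u :=
  mod_cast contDiff_infty.1 hsol.1 2

/-- The two-point estimate: `u x * v y` grows at most quadratically in the distance of the points. -/
lemma IsSolution.mul_le (hsol : IsSolution u v) {C₀ : ℝ} (hC₀ : 0 < C₀)
    (hgrowth : ∀ x, u x + v x ≤ C₀ * (1 + ‖x‖)) (x y : EuclideanSpace ℝ (Fin n)) :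
    u x * v y ≤ (8 + 4 * C₀ ^ 2 * (n + 2) ^ 2) * (2 + ‖x - y‖) ^ 2 := by
  have hu2 := hsol.contDiff_two
  have hv2 := hsol.symm.contDiff_two
  obtain ⟨-, -, hupos, hvpos, hlapu, hlapv⟩ := hsol
  set M := 8 + 4 * C₀ ^ 2 * ((n : ℝ) + 2) ^ 2 with hM
  have hM8 : 8 ≤ M := by rw [hM]; linarith [show 0 ≤ 4 * C₀ ^ 2 * ((n : ℝ) + 2) ^ 2 by positivity]
  set R := 1 + ‖x‖ ^ 2 + ‖y‖ ^ 2 with hR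
  have hR1 : 1 ≤ R := by rw [hR]; nlinarith [sq_nonneg ‖x‖, sq_nonneg ‖y‖]
  have hR0 : 0 < R := by linarith
  have hxR : ‖x‖ ≤ R := by rw [hR]; nlinarith [sq_nonneg (‖x‖ - 1), sq_nonneg ‖y‖, sq_nonneg ‖x‖]
  have hyR : ‖y‖ ≤ R := by rw [hR]; nlinarith [sq_nonneg (‖y‖ - 1), sq_nonneg ‖x‖, sq_nonneg ‖y‖]
  have hn0 : (0 : ℝ) < n + 2 := by positivity
  set ε := 1 / ((n + 2) * R) with hε
  set δ := (n + 2) * ε / 2 with hδ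
  have hε0 : 0 < ε := by positivity
  have hδ0 : 0 < δ := by positivity
  have hεR : ε * R * (n + 2) = 1 := by rw [hε]; field_simp
  have hδR : δ * (2 * R) = 1 := by rw [hδ]; linarith
  have hεn : n * ε ≤ 1 := by
    have : ε * (n + 2) ≤ ε * (n + 2) * R := le_mul_of_one_le_right (by positivity) hR1
    linarith
  set K := closedBall (0 : EuclideanSpace ℝ (Fin n)) R ×ˢ
    closedBall (0 : EuclideanSpace ℝ (Fin n)) R with hK
  have hweight (z : EuclideanSpace ℝ (Fin n) × EuclideanSpace ℝ (Fin n)) (hz : z ∈ K) :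
      1 + ε * (‖z.1‖ ^ 2 + ‖z.2‖ ^ 2) ≤ twoPointWeight δ ε z.1 z.2 := by
    have h1 : ‖z.1‖ ≤ R := by simpa using hz.1
    have h2 : ‖z.2‖ ≤ R := by simpa using hz.2
    have h3 : ‖z.1 - z.2‖ ≤ 2 * R := (norm_sub_le _ _).trans (by linarith)
    have h4 : δ * ‖z.1 - z.2‖ ≤ 1 := hδR ▸ mul_le_mul_of_nonneg_left h3 hδ0.le
    have h5 := mul_le_mul_of_nonneg_right h4 (norm_nonneg (z.1 - z.2))
    rw [twoPointWeight]
    linarith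
  have hweight1 (z : EuclideanSpace ℝ (Fin n) × EuclideanSpace ℝ (Fin n)) (hz : z ∈ K) :
      1 ≤ twoPointWeight δ ε z.1 z.2 :=
    le_trans (le_add_of_nonneg_right (by positivity)) (hweight z hz)
  have hcont : ContinuousOn (fun z : EuclideanSpace ℝ (Fin n) × EuclideanSpace ℝ (Fin n) =>
      u z.1 * v z.2 / twoPointWeight δ ε z.1 z.2 ^ 2) K := by
    have := hu2.continuous
    have := hv2.continuous
    refine ContinuousOn.div (by fun_prop) ((continuous_twoPointWeight δ ε).pow 2).continuousOn
      fun z hz => ?_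
    have := hweight1 z hz
    positivity
  have hxyK : (x, y) ∈ K := ⟨by simpa using hxR, by simpa using hyR⟩
  obtain ⟨⟨a, b⟩, hab, hmax⟩ := ((isCompact_closedBall _ _).prod
    (isCompact_closedBall _ _)).exists_isMaxOn ⟨_, hxyK⟩ hcont
  set m := u a * v b / twoPointWeight δ ε a b ^ 2 with hm
  have hab1 := hweight1 _ hab
  have hm0 : 0 < m := div_pos (mul_pos (hupos a) (hvpos b)) (by positivity)
  have hmle (z : EuclideanSpace ℝ (Fin n) × EuclideanSpace ℝ (Fin n)) (hz : z ∈ K) :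
      u z.1 * v z.2 ≤ m * twoPointWeight δ ε z.1 z.2 ^ 2 := by
    have h1 : u z.1 * v z.2 / twoPointWeight δ ε z.1 z.2 ^ 2 ≤ m := hmax hz
    have h2 := hweight1 z hz
    rwa [div_le_iff₀ (by positivity)] at h1
  have hmM : m ≤ M := by
    have haR : ‖a‖ ≤ R := by simpa using hab.1
    have hbR : ‖b‖ ≤ R := by simpa using hab.2
    by_cases hint : ‖a‖ < R ∧ ‖b‖ < R
    · have hnhds : K ∈ nhds (a, b) := prod_mem_nhds
        (closedBall_mem_nhds_of_mem (by simpa using hint.1))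
        (closedBall_mem_nhds_of_mem (by simpa using hint.2))
      have h : IsTwoPointMax u v δ ε m a b :=
        { nonneg := hm0.le
          eq := by rw [hm]; field_simp
          le := Filter.mem_of_superset hnhds hmle
          pos := by linarith }
      have heq : a = b := h.eq_of_lap_pos hu2 hv2 (hupos a) (hvpos b)
        (by rw [hlapu]; exact mul_pos (hupos a) (pow_pos (hvpos a) 2))
        (by rw [hlapv]; exact mul_pos (hvpos b) (pow_pos (hupos b) 2)) hε0 hδ
        (by linarith [hweight _ hab])
      subst heq
      exact (h.le_of_diagonal hu2 hv2 (hlapu a) (hlapv a) hm0 hεn hab1).trans hM8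
    · have h1 : R ^ 2 ≤ ‖a‖ ^ 2 + ‖b‖ ^ 2 := by
        rw [not_and_or, not_lt, not_lt] at hint
        rcases hint with h | h
        · have := pow_le_pow_left₀ hR0.le h 2
          linarith [sq_nonneg ‖b‖]
        · have := pow_le_pow_left₀ hR0.le h 2
          linarith [sq_nonneg ‖a‖]
      have h2 : ε * R ^ 2 ≤ twoPointWeight δ ε a b := by
        have h3 := mul_le_mul_of_nonneg_left h1 hε0.le
        have h4 := hweight _ hab
        simp only at h4
        linarith
      have hua : u a ≤ C₀ * (2 * R) := by
        have h3 : C₀ * (1 + ‖a‖) ≤ C₀ * (2 * R) := by gcongr; linarith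
        linarith [hgrowth a, hvpos a]
      have hvb : v b ≤ C₀ * (2 * R) := by
        have h3 : C₀ * (1 + ‖b‖) ≤ C₀ * (2 * R) := by gcongr; linarith
        linarith [hgrowth b, hupos b]
      rw [hm, div_le_iff₀ (by positivity)]
      calc u a * v b ≤ (C₀ * (2 * R)) * (C₀ * (2 * R)) :=
            mul_le_mul hua hvb (hvpos b).le (by positivity)
        _ = 4 * C₀ ^ 2 * R ^ 2 * (ε * R * (n + 2)) ^ 2 := by rw [hεR]; ring
        _ = (4 * C₀ ^ 2 * (n + 2) ^ 2) * (ε * R ^ 2) ^ 2 := by ring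
        _ ≤ M * twoPointWeight δ ε a b ^ 2 := by
          gcongr
          rw [hM]; linarith
  have hw : twoPointWeight δ ε x y ≤ 2 + ‖x - y‖ := by
    have h1 : ε * (‖x‖ ^ 2 + ‖y‖ ^ 2) ≤ ε * R * (n + 2) := by
      have h2 : ‖x‖ ^ 2 + ‖y‖ ^ 2 ≤ R := by rw [hR]; linarith
      calc ε * (‖x‖ ^ 2 + ‖y‖ ^ 2) ≤ ε * R := by gcongr
        _ ≤ ε * R * (n + 2) := le_mul_of_one_le_right (by positivity) (by
          have : (0 : ℝ) ≤ n := n.cast_nonneg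
          linarith)
    have h3 : 0 ≤ δ * ‖x - y‖ ^ 2 := by positivity
    rw [twoPointWeight]
    linarith
  have h1 := hweight1 _ hxyK
  simp only at h1
  calc u x * v y ≤ m * twoPointWeight δ ε x y ^ 2 := hmle _ hxyK
    _ ≤ M * (2 + ‖x - y‖) ^ 2 := by gcongr

end TwoPoint

section GradientBounds

variable {n : ℕ} {u v : EuclideanSpace ℝ (Fin n) → ℝ} {M C T : ℝ}

lemma IsSolution.le_mul_one_add (hsol : IsSolution u v)
    (hM : ∀ x y, u x * v y ≤ M * (2 + ‖x - y‖) ^ 2) {x y : EuclideanSpace ℝ (Fin n)}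
    (hxy : dist x y ≤ 1 / 2) :
    u y ≤ 2 ^ n * 6 * Real.exp (2 * (21 * M) ^ 2) * (1 + u x) := by
  have hu2 := hsol.contDiff_two
  obtain ⟨-, -, hupos, hvpos, hlapu, -⟩ := hsol
  set C := 2 ^ n * 6 * Real.exp (2 * (21 * M) ^ 2) with hC
  have hC1 : 1 ≤ C := by
    have h1 : (1 : ℝ) ≤ 2 ^ n := one_le_pow₀ (by norm_num)
    have h2 : 1 ≤ Real.exp (2 * (21 * M) ^ 2) := Real.one_le_exp (by positivity)
    nlinarith
  have hux := hupos x
  rcases le_or_gt (u y) 1 with hy | hy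
  · nlinarith
  have hM0 : 0 ≤ M := by
    have h1 := hM x x
    have h2 := mul_pos (hupos x) (hvpos x)
    rw [sub_self, norm_zero] at h1
    linarith
  have h := harnack hu2 (fun z => (hupos z).le)
    (fun z => by rw [hlapu]; exact mul_nonneg (hupos z).le (sq_nonneg _))
    (sq_nonneg (21 * M)) hxy fun z hz => by
      have h1 : ‖y - z‖ ≤ 5 / 2 := by
        rw [← dist_eq_norm]
        have := dist_triangle y x z
        rw [dist_comm y x, dist_comm x z] at this
        linarith [mem_closedBall.1 hz]
      have h2 : M * (2 + ‖y - z‖) ^ 2 ≤ M * (2 + 5 / 2) ^ 2 := by gcongr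
      have h3 : v z ≤ u y * v z := le_mul_of_one_le_left (hvpos z).le hy.le
      have h4 : v z ≤ 21 * M := by linarith [hM y z]
      rw [hlapu, mul_comm]
      exact mul_le_mul_of_nonneg_right (pow_le_pow_left₀ (hvpos z).le h4 2) (hupos z).le
  nlinarith

/-- The gradient bound where one of the components is large. -/
lemma IsSolution.gradient_bound_of_large (hsol : IsSolution u v) (hM0 : 0 ≤ M)
    (hM : ∀ x y, u x * v y ≤ M * (2 + ‖x - y‖) ^ 2) (hC : 1 ≤ C)
    (hharnack : ∀ x y, dist x y ≤ 1 / 2 → u y ≤ C * (1 + u x)) :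
    ∃ K, ∀ x, 2 * C ≤ u x → u x * ‖gradient v x‖ + v x * ‖gradient u x‖ ≤ K := by
  have hu2 := hsol.contDiff_two
  have hv2 := hsol.symm.contDiff_two
  obtain ⟨-, -, hupos, hvpos, hlapu, hlapv⟩ := hsol
  set L := 896 * n * M * C ^ 2 with hL
  refine ⟨4 * n * L + (4 * C ^ 2 * L + 1) / 8 +
    7 * M * (8 * n * C + (98 * C * M ^ 2 + 1) / 8), fun x hx => ?_⟩
  set A := u x with hA
  have hA1 : 1 ≤ A := by linarith
  have hA0 : 0 < A := by linarith
  have hC0 : 0 < C := by linarith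
  have hL0 : 0 ≤ L := by positivity
  have hupper (y) (hy : dist x y ≤ 1 / 2) : u y ≤ 2 * C * A := by
    have h1 := hharnack x y hy
    have h2 : C * 1 ≤ C * A := by gcongr
    linarith
  have hlower (y) (hy : dist x y ≤ 1 / 2) : A / (2 * C) ≤ u y := by
    have h1 := hharnack y x (by rwa [dist_comm])
    rw [div_le_iff₀ (by positivity)]
    linarith
  have hvbound (y) (hy : dist x y ≤ 1 / 2) : v y ≤ 7 * M / A := by
    rw [le_div_iff₀ hA0, mul_comm]
    rw [dist_eq_norm] at hy
    have h2 : M * (2 + ‖x - y‖) ^ 2 ≤ M * (2 + 1 / 2) ^ 2 := by gcongr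
    linarith [hM x y]
  have hvdecay (y) (hy : y ∈ closedBall x (1 / 4)) : v y ≤ L / A ^ 3 := by
    have hdist (z) (hz : z ∈ closedBall y (1 / 4)) : dist x z ≤ 1 / 2 := by
      have := dist_triangle z y x
      rw [dist_comm]
      linarith [mem_closedBall.1 hz, mem_closedBall.1 hy]
    refine (le_of_mul_le_lap hv2 (ρ := 1 / 4) (S := 7 * M / A) (κ := (A / (2 * C)) ^ 2)
      (by norm_num) (by positivity) (by positivity) (fun z hz => hvbound z (hdist z hz))
      fun z hz => ?_).trans_eq ?_
    · rw [hlapv, mul_comm]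
      have := hvpos z
      have := hlower z (hdist z hz)
      gcongr
    · rw [hL]
      field_simp
      ring
  have hdist (z) (hz : z ∈ closedBall x (1 / 4)) : dist x z ≤ 1 / 2 := by
    rw [dist_comm]
    linarith [mem_closedBall.1 hz]
  have hgradv : ‖gradient v x‖ ≤ n * (L / A ^ 3) / (1 / 4) +
      (L / A ^ 3 * (2 * C * A) ^ 2 + 1 / A) * (1 / 4) / 2 := by
    refine norm_gradient_le_of_bounds hv2 (by norm_num) (fun y hy => ?_) fun y hy => ?_
    · rw [abs_of_pos (hvpos y)]
      exact hvdecay y hy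
    · have h0 := hvpos y
      have h1 := hupos y
      have h2 := hvdecay y hy
      have h3 := hupper y (hdist y hy)
      rw [hlapv, abs_of_pos (by positivity)]
      have h4 : v y * u y ^ 2 ≤ L / A ^ 3 * (2 * C * A) ^ 2 := by gcongr
      have h5 : 0 < 1 / A := by positivity
      linarith
  have hgradu : ‖gradient u x‖ ≤ n * (2 * C * A) / (1 / 4) +
      (A * (98 * C * M ^ 2 + 1)) * (1 / 4) / 2 := by
    refine norm_gradient_le_of_bounds hu2 (by norm_num) (fun y hy => ?_) fun y hy => ?_
    · rw [abs_of_pos (hupos y)]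
      exact hupper y (hdist y hy)
    · have h0 := hvpos y
      have h1 := hupos y
      have h2 : v y ≤ 7 * M :=
        (hvbound y (hdist y hy)).trans (div_le_self (by positivity) hA1)
      have h3 := hupper y (hdist y hy)
      rw [hlapu, abs_of_pos (by positivity)]
      have h4 : u y * v y ^ 2 ≤ 2 * C * A * (7 * M) ^ 2 := by gcongr
      linarith
  have h1 : A * ‖gradient v x‖ ≤ 4 * n * L + (4 * C ^ 2 * L + 1) / 8 := by
    calc A * ‖gradient v x‖ ≤ A * (n * (L / A ^ 3) / (1 / 4) +
          (L / A ^ 3 * (2 * C * A) ^ 2 + 1 / A) * (1 / 4) / 2) := by gcongr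
      _ = 4 * n * (L / A ^ 2) + (4 * C ^ 2 * L + 1) / 8 := by field_simp; ring
      _ ≤ _ := by gcongr; exact div_le_self hL0 (one_le_pow₀ hA1)
  have h2 : v x * ‖gradient u x‖ ≤ 7 * M * (8 * n * C + (98 * C * M ^ 2 + 1) / 8) := by
    have h3 := hvbound x (by simp)
    calc v x * ‖gradient u x‖ ≤ 7 * M / A * (n * (2 * C * A) / (1 / 4) +
          (A * (98 * C * M ^ 2 + 1)) * (1 / 4) / 2) := by gcongr
      _ = _ := by field_simp; ring
  linarith

/-- The gradient bound where both components are bounded. -/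
lemma IsSolution.gradient_bound_of_small (hsol : IsSolution u v) (hC : 0 ≤ C) (hT : 0 ≤ T)
    (hharnack : ∀ x y, dist x y ≤ 1 / 2 → u y ≤ C * (1 + u x) ∧ v y ≤ C * (1 + v x))
    {x : EuclideanSpace ℝ (Fin n)} (hux : u x ≤ T) (hvx : v x ≤ T) :
    u x * ‖gradient v x‖ + v x * ‖gradient u x‖ ≤
      2 * (T * (n * (C * (1 + T)) / (1 / 2) + ((C * (1 + T)) ^ 3 + 1) * (1 / 2) / 2)) := by
  have hu2 := hsol.contDiff_two
  have hv2 := hsol.symm.contDiff_two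
  obtain ⟨-, -, hupos, hvpos, hlapu, hlapv⟩ := hsol
  set W := C * (1 + T) with hW
  have hbound (y) (hy : y ∈ closedBall x (1 / 2)) : u y ≤ W ∧ v y ≤ W := by
    have h1 := hharnack x y (by rw [dist_comm]; exact mem_closedBall.1 hy)
    exact ⟨h1.1.trans (by rw [hW]; gcongr), h1.2.trans (by rw [hW]; gcongr)⟩
  have hcube {a b : ℝ} (ha : 0 < a) (hb : 0 < b) (haW : a ≤ W) (hbW : b ≤ W) :
      |a * b ^ 2| < W ^ 3 + 1 := by
    rw [abs_of_pos (by positivity)]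
    calc a * b ^ 2 ≤ W * W ^ 2 := by gcongr
      _ < W ^ 3 + 1 := by linarith [show W * W ^ 2 = W ^ 3 by ring]
  have hgradv : ‖gradient v x‖ ≤ n * W / (1 / 2) + (W ^ 3 + 1) * (1 / 2) / 2 := by
    refine norm_gradient_le_of_bounds hv2 (by norm_num) (fun y hy => ?_) fun y hy => ?_
    · rw [abs_of_pos (hvpos y)]
      exact (hbound y hy).2
    · rw [hlapv]
      exact hcube (hvpos y) (hupos y) (hbound y hy).2 (hbound y hy).1
  have hgradu : ‖gradient u x‖ ≤ n * W / (1 / 2) + (W ^ 3 + 1) * (1 / 2) / 2 := by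
    refine norm_gradient_le_of_bounds hu2 (by norm_num) (fun y hy => ?_) fun y hy => ?_
    · rw [abs_of_pos (hupos y)]
      exact (hbound y hy).1
    · rw [hlapu]
      exact hcube (hupos y) (hvpos y) (hbound y hy).1 (hbound y hy).2
  have h1 := mul_le_mul hux hgradv (norm_nonneg _) hT
  have h2 := mul_le_mul hvx hgradu (norm_nonneg _) hT
  linarith

end GradientBounds

/-- For an entire solution with linear growth, u|∇v| + v|∇u| is uniformly bounded. -/
theorem mixed_gradient_bound {n : ℕ} (hn : 2 ≤ n)
    (u v : EuclideanSpace ℝ (Fin n) → ℝ) (hsol : IsSolution u v)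
    (C₀ : ℝ) (hC₀ : 0 < C₀) (hgrowth : ∀ x, u x + v x ≤ C₀ * (1 + ‖x‖)) :
    ∃ C : ℝ, 0 < C ∧ ∀ x : EuclideanSpace ℝ (Fin n),
      u x * ‖gradient v x‖ + v x * ‖gradient u x‖ ≤ C := by
  obtain ⟨M, hM0, hM⟩ : ∃ M : ℝ, 0 ≤ M ∧ ∀ x y, u x * v y ≤ M * (2 + ‖x - y‖) ^ 2 :=
    ⟨_, by positivity, hsol.mul_le hC₀ hgrowth⟩
  have hM' (x y) : v x * u y ≤ M * (2 + ‖x - y‖) ^ 2 := by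
    rw [mul_comm, norm_sub_rev]
    exact hM y x
  set C := 2 ^ n * 6 * Real.exp (2 * (21 * M) ^ 2) with hC
  have hC1 : 1 ≤ C := by
    have h1 : (1 : ℝ) ≤ 2 ^ n := one_le_pow₀ (by norm_num)
    have h2 : 1 ≤ Real.exp (2 * (21 * M) ^ 2) := Real.one_le_exp (by positivity)
    nlinarith
  have hu (x y) (hxy : dist x y ≤ 1 / 2) : u y ≤ C * (1 + u x) := hsol.le_mul_one_add hM hxy
  have hv (x y) (hxy : dist x y ≤ 1 / 2) : v y ≤ C * (1 + v x) :=
    hsol.symm.le_mul_one_add hM' hxy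
  obtain ⟨K₁, hK₁⟩ := hsol.gradient_bound_of_large hM0 hM hC1 hu
  obtain ⟨K₂, hK₂⟩ := hsol.symm.gradient_bound_of_large hM0 hM' hC1 hv
  obtain ⟨K₃, hK₃⟩ : ∃ K, ∀ x, u x ≤ 2 * C → v x ≤ 2 * C →
      u x * ‖gradient v x‖ + v x * ‖gradient u x‖ ≤ K :=
    ⟨_, fun x => hsol.gradient_bound_of_small (by linarith) (by linarith)
      fun x y hxy => ⟨hu x y hxy, hv x y hxy⟩⟩
  refine ⟨max 1 (max K₁ (max K₂ K₃)), by positivity, fun x => ?_⟩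
  simp only [le_max_iff]
  rcases le_total (2 * C) (u x) with h1 | h1
  · exact Or.inr (Or.inl (hK₁ x h1))
  rcases le_total (2 * C) (v x) with h2 | h2
  · exact Or.inr (Or.inr (Or.inl (by linarith [hK₂ x h2])))
  · exact Or.inr (Or.inr (Or.inr (hK₃ x h1 h2)))
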